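/- Let u be a fuzzy number. Then u belongs to F_C(ℝ) if and only if the following two conditions hold: (i) u⁻(α) ≠ u⁻(β) for all α, β ∈ [u(u⁻(0)), 1] with α ≠ β; and (ii) u⁺(α) ≠ u⁺(β) for all α, β ∈ [u(u⁺(0)), 1] with α ≠ β. -/

import Mathlib

open Set Filter Topology

/-- A fuzzy number: a function `ℝ → ℝ` taking values in `[0,1]`, whose `α`-cuts
(for `α ∈ (0,1]`) and whose `0`-cut (the closure of the support) are nonempty
compact intervals. -/
structure FuzzyNumber where
  f : ℝ → ℝ
  mem_Icc : ∀ x, f x ∈ Set.Icc (0 : ℝ) 1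
  cut_isIcc : ∀ α ∈ Set.Ioc (0 : ℝ) 1, ∃ a b : ℝ, a ≤ b ∧ {x | α ≤ f x} = Set.Icc a b
  supp_isIcc : ∃ a b : ℝ, a ≤ b ∧ closure {x | 0 < f x} = Set.Icc a b

namespace FuzzyNumber

/-- The `α`-cut of a fuzzy number; for `α = 0` it is the closure of the support. -/
noncomputable def cut (u : FuzzyNumber) (α : ℝ) : Set ℝ :=
  if α = 0 then closure {x | 0 < u.f x} else {x | α ≤ u.f x}

/-- Left endpoint `u⁻(α)` of the `α`-cut. -/
noncomputable def lo (u : FuzzyNumber) (α : ℝ) : ℝ := sInf (u.cut α)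

/-- Right endpoint `u⁺(α)` of the `α`-cut. -/
noncomputable def hi (u : FuzzyNumber) (α : ℝ) : ℝ := sSup (u.cut α)

/-- Left endpoint `u_s⁻(α)` of the strong `α`-cut: `lim_{β→α⁺} u⁻(β)` for `α < 1`,
and `u⁻(1)` for `α = 1`.  Since `u⁻` is nondecreasing, this right limit is the
infimum of `u⁻` over `(α,1]`. -/
noncomputable def slo (u : FuzzyNumber) (α : ℝ) : ℝ :=
  if α < 1 then sInf (u.lo '' Set.Ioc α 1) else u.lo 1

/-- Right endpoint `u_s⁺(α)` of the strong `α`-cut: `lim_{β→α⁺} u⁺(β)` for `α < 1`,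
and `u⁺(1)` for `α = 1`. -/
noncomputable def shi (u : FuzzyNumber) (α : ℝ) : ℝ :=
  if α < 1 then sSup (u.hi '' Set.Ioc α 1) else u.hi 1

/-- The sup-min convolution `u∇v` of two fuzzy numbers, as a function on `ℝ`:
`(u∇v)(x) = sup_y min (u y) (v (x - y))`.  Its cut functions satisfy
`(u∇v)⁻(α) = u⁻(α) + v⁻(α)` and `(u∇v)⁺(α) = u⁺(α) + v⁺(α)`. -/
noncomputable def conv (u v : FuzzyNumber) (x : ℝ) : ℝ :=
  ⨆ y : ℝ, min (u.f y) (v.f (x - y))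

end FuzzyNumber

/-- `f` has left derivative `f'` at `x`. -/
def HasLeftDerivAt (f : ℝ → ℝ) (f' x : ℝ) : Prop :=
  HasDerivWithinAt f f' (Set.Iio x) x

/-- `f` has right derivative `f'` at `x`. -/
def HasRightDerivAt (f : ℝ → ℝ) (f' x : ℝ) : Prop :=
  HasDerivWithinAt f f' (Set.Ioi x) x

/-- A monotone function on a compact interval attaining all intermediate values is continuous. -/
theorem MonotoneOn.continuousOn_Icc_of_surjOn {f : ℝ → ℝ} {a b : ℝ}
    (hf : MonotoneOn f (Set.Icc a b)) (hs : Set.SurjOn f (Set.Icc a b) (Set.Icc (f a) (f b))) :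
    ContinuousOn f (Set.Icc a b) := by
  intro x hx
  have hab : a ≤ b := hx.1.trans hx.2
  have hax : f a ≤ f x := hf ⟨le_rfl, hab⟩ hx hx.1
  have hxb : f x ≤ f b := hf hx ⟨hab, le_rfl⟩ hx.2
  refine tendsto_order.2 ⟨fun l hl => ?_, fun r hr => ?_⟩
  · rcases lt_or_ge l (f a) with h | h
    · filter_upwards [self_mem_nhdsWithin] with y hy
      exact h.trans_le (hf ⟨le_rfl, hab⟩ hy hy.1)
    · obtain ⟨γ, hlγ, hγx⟩ := exists_between hl
      obtain ⟨c, hc, rfl⟩ := hs ⟨h.trans hlγ.le, hγx.le.trans hxb⟩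
      have hcx : c < x := lt_of_not_ge fun h' => (hf hx hc h').not_gt hγx
      filter_upwards [self_mem_nhdsWithin, mem_nhdsWithin_of_mem_nhds (Ioi_mem_nhds hcx)]
        with y hy hcy
      exact hlγ.trans_le (hf hc hy (le_of_lt hcy))
  · rcases lt_or_ge (f b) r with h | h
    · filter_upwards [self_mem_nhdsWithin] with y hy
      exact (hf hy ⟨hab, le_rfl⟩ hy.2).trans_lt h
    · obtain ⟨γ, hxγ, hγr⟩ := exists_between hr
      obtain ⟨c, hc, rfl⟩ := hs ⟨hax.trans hxγ.le, hγr.le.trans h⟩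
      have hxc : x < c := lt_of_not_ge fun h' => (hf hc hx h').not_gt hxγ
      filter_upwards [self_mem_nhdsWithin, mem_nhdsWithin_of_mem_nhds (Iio_mem_nhds hxc)]
        with y hy hyc
      exact (hf hy hc (le_of_lt hyc)).trans_lt hγr

namespace FuzzyNumber

/-- The reflection `x ↦ u (-x)` of a fuzzy number. -/
def reflect (u : FuzzyNumber) : FuzzyNumber where
  f x := u.f (-x)
  mem_Icc x := u.mem_Icc (-x)
  cut_isIcc α hα := by
    obtain ⟨a, b, hab, h⟩ := u.cut_isIcc α hα
    refine ⟨-b, -a, neg_le_neg hab, ?_⟩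
    rw [← Set.neg_Icc, ← h]
    rfl
  supp_isIcc := by
    obtain ⟨a, b, hab, h⟩ := u.supp_isIcc
    refine ⟨-b, -a, neg_le_neg hab, ?_⟩
    rw [← Set.neg_Icc, ← h]
    exact ((Homeomorph.neg ℝ).preimage_closure {x | 0 < u.f x}).symm

theorem reflect_f (u : FuzzyNumber) (x : ℝ) : u.reflect.f x = u.f (-x) := rfl

theorem reflect_cut (u : FuzzyNumber) (α : ℝ) : u.reflect.cut α = -u.cut α := by
  unfold cut
  split_ifs
  · exact ((Homeomorph.neg ℝ).preimage_closure {x | 0 < u.f x}).symm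
  · rfl

theorem reflect_lo (u : FuzzyNumber) (α : ℝ) : u.reflect.lo α = -u.hi α := by
  rw [lo, reflect_cut, Real.sInf_neg, hi]

theorem lo_le_of_pos (u : FuzzyNumber) {α x : ℝ} (hα : 0 < α) (hx : α ≤ u.f x) :
    u.lo α ≤ x := by
  obtain ⟨a, b, hab, h⟩ := u.cut_isIcc α ⟨hα, hx.trans (u.mem_Icc x).2⟩
  have hx' : x ∈ Set.Icc a b := h ▸ hx
  rw [lo, cut, if_neg hα.ne', h, csInf_Icc hab]
  exact hx'.1

theorem le_f_lo (u : FuzzyNumber) {α : ℝ} (hα : α ∈ Set.Ioc (0 : ℝ) 1) :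
    α ≤ u.f (u.lo α) := by
  obtain ⟨a, b, hab, h⟩ := u.cut_isIcc α hα
  have ha : a ∈ {x | α ≤ u.f x} := h ▸ Set.left_mem_Icc.2 hab
  rwa [lo, cut, if_neg hα.1.ne', h, csInf_Icc hab]

theorem mem_Icc_lo_hi_of_pos (u : FuzzyNumber) {x : ℝ} (hx : 0 < u.f x) :
    x ∈ Set.Icc (u.lo 0) (u.hi 0) := by
  obtain ⟨a, b, hab, h⟩ := u.supp_isIcc
  have hx' : x ∈ closure {x | 0 < u.f x} := subset_closure hx
  rw [lo, hi, cut, if_pos rfl, h, csInf_Icc hab, csSup_Icc hab]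
  rwa [h] at hx'

theorem exists_f_eq_one (u : FuzzyNumber) : ∃ m, u.f m = 1 :=
  ⟨u.lo 1, le_antisymm (u.mem_Icc _).2 (u.le_f_lo ⟨one_pos, le_rfl⟩)⟩

theorem monotoneOn_Iic (u : FuzzyNumber) {m : ℝ} (hm : u.f m = 1) :
    MonotoneOn u.f (Set.Iic m) := by
  intro x _ y hy hxy
  rcases (u.mem_Icc x).1.eq_or_lt with h | h
  · exact h ▸ (u.mem_Icc y).1
  obtain ⟨a, b, -, hc⟩ := u.cut_isIcc (u.f x) ⟨h, (u.mem_Icc x).2⟩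
  have hxc : x ∈ Set.Icc a b := hc ▸ le_refl (u.f x)
  have hmc : m ∈ Set.Icc a b := hc ▸ ((u.mem_Icc x).2.trans hm.ge : u.f x ≤ u.f m)
  have hyc : y ∈ {z | u.f x ≤ u.f z} := hc ▸ ⟨hxc.1.trans hxy, le_trans hy hmc.2⟩
  exact hyc

/-- The left branch of `u` is continuous exactly when `u⁻` is injective on `[u(u⁻(0)), 1]`. -/
theorem continuousOn_Icc_lo_iff (u : FuzzyNumber) {m : ℝ} (hm : u.f m = 1) :
    ContinuousOn u.f (Set.Icc (u.lo 0) m) ↔ Set.InjOn u.lo (Set.Icc (u.f (u.lo 0)) 1) := by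
  have hlm : u.lo 0 ≤ m := (u.mem_Icc_lo_hi_of_pos (hm ▸ one_pos)).1
  have h0 : 0 ≤ u.f (u.lo 0) := (u.mem_Icc _).1
  constructor
  · intro hcont
    have key : ∀ α ∈ Set.Icc (u.f (u.lo 0)) 1, ∀ β ∈ Set.Icc (u.f (u.lo 0)) 1,
        α < β → u.lo α ≠ u.lo β := by
      intro α hα β hβ hαβ heq
      have hβ0 : 0 < β := (h0.trans hα.1).trans_lt hαβ
      have hfβ : β ≤ u.f (u.lo β) := u.le_f_lo ⟨hβ0, hβ.2⟩
      have hβm : u.lo β ≤ m := u.lo_le_of_pos hβ0 (hm ▸ hβ.2)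
      have hlβ : u.lo 0 ≤ u.lo β := (u.mem_Icc_lo_hi_of_pos (hβ0.trans_le hfβ)).1
      obtain ⟨y, hy, rfl⟩ := intermediate_value_Icc hlβ
        (hcont.mono (Set.Icc_subset_Icc_right hβm)) ⟨hα.1, hαβ.le.trans hfβ⟩
      have hyβ : y < u.lo β := hy.2.lt_of_ne fun h => (hαβ.trans_le hfβ).ne (h ▸ rfl)
      rcases (u.mem_Icc y).1.eq_or_lt with h | h
      · rw [← h] at heq
        exact (hy.1.trans_lt hyβ).ne heq
      · exact (heq ▸ u.lo_le_of_pos h le_rfl).not_gt hyβ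
    intro α hα β hβ heq
    rcases lt_trichotomy α β with h | h | h
    · exact (key α hα β hβ h heq).elim
    · exact h
    · exact (key β hβ α hα h heq.symm).elim
  · intro hinj
    refine ((u.monotoneOn_Iic hm).mono Set.Icc_subset_Iic_self).continuousOn_Icc_of_surjOn ?_
    rw [hm]
    intro γ hγ
    rcases (h0.trans hγ.1).eq_or_lt with h | h
    · exact ⟨u.lo 0, ⟨le_rfl, hlm⟩, le_antisymm hγ.1 (h ▸ h0)⟩
    · have hfγ : γ ≤ u.f (u.lo γ) := u.le_f_lo ⟨h, hγ.2⟩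
      have hδ : u.f (u.lo γ) ∈ Set.Ioc (0 : ℝ) 1 := ⟨h.trans_le hfγ, (u.mem_Icc _).2⟩
      refine ⟨u.lo γ, ⟨(u.mem_Icc_lo_hi_of_pos hδ.1).1, u.lo_le_of_pos h (hm ▸ hγ.2)⟩, ?_⟩
      exact hinj ⟨hγ.1.trans hfγ, hδ.2⟩ hγ <| le_antisymm (u.lo_le_of_pos hδ.1 le_rfl)
        (u.lo_le_of_pos h (hfγ.trans (u.le_f_lo hδ)))

/-- The right branch of `u` is continuous exactly when `u⁺` is injective on `[u(u⁺(0)), 1]`. -/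
theorem continuousOn_Icc_hi_iff (u : FuzzyNumber) {m : ℝ} (hm : u.f m = 1) :
    ContinuousOn u.f (Set.Icc m (u.hi 0)) ↔ Set.InjOn u.hi (Set.Icc (u.f (u.hi 0)) 1) := by
  have h := u.reflect.continuousOn_Icc_lo_iff (m := -m) (by rw [reflect_f, neg_neg, hm])
  have hlo : u.reflect.lo = fun α => -u.hi α := funext u.reflect_lo
  have hf : u.reflect.f = u.f ∘ Homeomorph.neg ℝ := rfl
  rw [reflect_f, hlo, neg_neg, hf, ← Set.neg_Icc] at h
  have hinj : Set.InjOn (fun α => -u.hi α) (Set.Icc (u.f (u.hi 0)) 1) ↔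
      Set.InjOn u.hi (Set.Icc (u.f (u.hi 0)) 1) := by
    simp only [Set.InjOn, neg_inj]
  rw [← hinj, ← h]
  refine ⟨fun hc => hc.comp continuous_neg.continuousOn fun _ hx => hx, fun hc => ?_⟩
  have hc' := hc.comp (t := -Set.Icc m (u.hi 0)) (s := Set.Icc m (u.hi 0))
    continuous_neg.continuousOn fun x hx => by rwa [Set.mem_neg, neg_neg]
  exact hc'.congr fun x _ => by simp

end FuzzyNumber

/-- Theorem `cfn`: `u ∈ F_C(ℝ)` (i.e. `u` is continuous on
`[u⁻(0), u⁺(0)]`) iff `u⁻` is injective on `[u(u⁻(0)), 1]` and `u⁺` is injective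
on `[u(u⁺(0)), 1]`. -/
theorem memFC_iff_injective_cuts (u : FuzzyNumber) :
    ContinuousOn u.f (Set.Icc (u.lo 0) (u.hi 0)) ↔
      ((∀ α ∈ Set.Icc (u.f (u.lo 0)) 1, ∀ β ∈ Set.Icc (u.f (u.lo 0)) 1,
          α ≠ β → u.lo α ≠ u.lo β) ∧
       (∀ α ∈ Set.Icc (u.f (u.hi 0)) 1, ∀ β ∈ Set.Icc (u.f (u.hi 0)) 1,
          α ≠ β → u.hi α ≠ u.hi β)) := by
  obtain ⟨m, hm⟩ := u.exists_f_eq_one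
  have hmem := u.mem_Icc_lo_hi_of_pos (hm ▸ one_pos)
  have hinj : ∀ (g : ℝ → ℝ) (s : Set ℝ),
      (∀ α ∈ s, ∀ β ∈ s, α ≠ β → g α ≠ g β) ↔ Set.InjOn g s := fun g s =>
    ⟨fun h α hα β hβ => not_imp_not.1 (h α hα β hβ), fun h α hα β hβ => (h hα hβ).mt⟩
  rw [hinj, hinj, ← u.continuousOn_Icc_lo_iff hm, ← u.continuousOn_Icc_hi_iff hm]
  refine ⟨fun h => ⟨h.mono (Set.Icc_subset_Icc_right hmem.2),
    h.mono (Set.Icc_subset_Icc_left hmem.1)⟩, fun h => ?_⟩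
  rw [← Set.Icc_union_Icc_eq_Icc hmem.1 hmem.2]
  exact h.1.union_of_isClosed h.2 isClosed_Icc isClosed_Icc
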